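/- arXiv:1207.3266 — 3 statements merged into one kernel-verified Lean document; each statement's English description precedes it below -/
import Mathlib

section
/- For all integers m ≥ 1 and n ≥ 1, S_k(m+n, 0, 0) = S_k(m, 0, n) · S_k(n, m, 0) + Σ_{i=2}^{k} Σ_{j=1}^{i−1} w(i, m−j+1, n−i+j) · S_k(m−j, 0, n+j) · S_k(n−i+j, m+i−j, 0), where the double sum is restricted to those pairs (i,j) with j ≤ m and i−j ≤ n (the omitted terms correspond to boards of negative length). -/
/-- The weighted sum `S_k(n,a,b)` over all compositions of `n` with parts in `{1,…,k}`:
each composition `c = (c_1,…,c_m)` with partial sums `p_0 = 0`, `p_j = c_1 + ⋯ + c_j`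
contributes `∏_{j=1}^m w(c_j, a + p_{j-1} + 1, b + n - p_j)`. -/
def weightedSum {R : Type*} [CommRing R] (w : ℕ → ℕ → ℕ → R) (k n a b : ℕ) : R :=
  ∑ c ∈ Finset.univ.filter (fun c : Composition n => ∀ i ∈ c.blocks, i ≤ k),
    ∏ j ∈ Finset.range c.length,
      w (c.blocks.getD j 0) (a + c.sizeUpTo j + 1) (b + n - c.sizeUpTo (j + 1))

/-- The product of the weights of the tiles of a tiling, given as a list of tile lengths, of a board
preceded by `a` cells and followed by `b` cells. -/
def tilingWeight {R : Type*} [CommRing R] (w : ℕ → ℕ → ℕ → R) (b : ℕ) : ℕ → List ℕ → R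
  | _, [] => 1
  | a, x :: l => w x (a + 1) (b + l.sum) * tilingWeight w b (a + x) l

theorem tilingWeight_eq_prod {R : Type*} [CommRing R] (w : ℕ → ℕ → ℕ → R) (b a : ℕ)
    (l : List ℕ) :
    ∏ j ∈ Finset.range l.length,
        w (l.getD j 0) (a + (l.take j).sum + 1) (b + l.sum - (l.take (j + 1)).sum)
      = tilingWeight w b a l := by
  induction l generalizing a with
  | nil => simp [tilingWeight]
  | cons x l ih =>
    rw [List.length_cons, Finset.prod_range_succ', tilingWeight, ← ih, mul_comm]
    congr 1
    · simp only [List.getD_cons_zero, List.take_zero, List.sum_nil, List.take_succ_cons,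
        List.sum_cons]
      congr 1
      omega
    · refine Finset.prod_congr rfl fun j _ => ?_
      simp only [List.getD_cons_succ, List.take_succ_cons, List.sum_cons]
      congr 1 <;> omega

theorem weightedSum_eq_sum_tilingWeight {R : Type*} [CommRing R] (w : ℕ → ℕ → ℕ → R)
    (k n a b : ℕ) :
    weightedSum w k n a b
      = ∑ c ∈ Finset.univ.filter (fun c : Composition n => ∀ i ∈ c.blocks, i ≤ k),
          tilingWeight w b a c.blocks := by
  refine Finset.sum_congr rfl fun c _ => ?_
  rw [← tilingWeight_eq_prod, c.blocks_sum]
  rfl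

theorem weightedSum_zero {R : Type*} [CommRing R] (w : ℕ → ℕ → ℕ → R) (k a b : ℕ) :
    weightedSum w k 0 a b = 1 := by
  have hnil (c : Composition 0) : c.blocks = [] := c.blocks_eq_nil.2 rfl
  simp [weightedSum_eq_sum_tilingWeight, hnil, tilingWeight, composition_card]

/-- Recurrence for `weightedSum` obtained by removing the first tile. -/
theorem weightedSum_eq_sum_first {R : Type*} [CommRing R] (w : ℕ → ℕ → ℕ → R)
    (k : ℕ) {n : ℕ} (hn : 0 < n) (a b : ℕ) :
    weightedSum w k n a b
      = ∑ i ∈ (Finset.Icc 1 n).filter (· ≤ k),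
          w i (a + 1) (b + (n - i)) * weightedSum w k (n - i) (a + i) b := by
  simp only [weightedSum_eq_sum_tilingWeight, Finset.mul_sum]
  rw [Finset.sum_sigma']
  symm
  refine Finset.sum_bij
    (fun x hx => ⟨x.1 :: x.2.blocks, fun {i} hi => ?_, ?_⟩) ?_ ?_ ?_ ?_
  · simp only [Finset.mem_sigma, Finset.mem_filter, Finset.mem_Icc] at hx
    rcases List.mem_cons.1 hi with rfl | hi
    · exact hx.1.1.1
    · exact x.2.blocks_pos hi
  · simp only [Finset.mem_sigma, Finset.mem_filter, Finset.mem_Icc] at hx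
    rw [List.sum_cons, x.2.blocks_sum]
    omega
  · rintro ⟨i, c⟩ hx
    simp only [Finset.mem_sigma, Finset.mem_filter, Finset.mem_univ, true_and] at hx
    simpa using ⟨hx.1.2, hx.2⟩
  · rintro ⟨i, c⟩ _ ⟨i', c'⟩ _ h
    simp only [Composition.mk.injEq, List.cons.injEq] at h
    obtain ⟨rfl, h⟩ := h
    rw [Composition.ext h]
  · rintro ⟨l, hpos, hsum⟩ hl
    simp only [Finset.mem_filter, Finset.mem_univ, true_and] at hl
    cases l with
    | nil => simp at hsum; omega
    | cons x l =>
      rw [List.sum_cons] at hsum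
      have hx := hpos List.mem_cons_self
      refine ⟨⟨x, l, fun hi => hpos (List.mem_cons_of_mem _ hi), by omega⟩, ?_, rfl⟩
      simp only [Finset.mem_sigma, Finset.mem_filter, Finset.mem_Icc, Finset.mem_univ, true_and]
      exact ⟨⟨by omega, hl x List.mem_cons_self⟩, fun i hi => hl i (List.mem_cons_of_mem _ hi)⟩
  · rintro ⟨i, c⟩ _
    simp [tilingWeight]

/-- If `F s e` is the total weight of the increasing paths from `s` to `e` with steps weighted by
`W`, then the paths from `s` to `N` split into those through `m` and those jumping over `m`. -/
theorem pathSum_split {R : Type*} [CommRing R] {F W : ℕ → ℕ → R} {N : ℕ}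
    (hF : ∀ s, F s s = 1)
    (hrec : ∀ s e, s < e → e ≤ N → F s e = ∑ t ∈ Finset.Ioc s e, W s t * F t e)
    {s m : ℕ} (hsm : s ≤ m) (hmN : m ≤ N) :
    F s N = F s m * F m N
      + ∑ p ∈ Finset.Ico s m, ∑ q ∈ Finset.Ioc m N, F s p * W p q * F q N := by
  induction hd : m - s using Nat.strong_induction_on generalizing s with
  | _ d ih =>
    rcases hsm.eq_or_lt with rfl | hlt
    · simp [hF]
    have hstep : ∀ t ∈ Finset.Ioc s m, W s t * F t N = W s t * F t m * F m N
        + ∑ p ∈ Finset.Ico t m, W s t * F t p * ∑ q ∈ Finset.Ioc m N, W p q * F q N := by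
      intro t ht
      rw [Finset.mem_Ioc] at ht
      rw [ih (m - t) (by omega) ht.2 rfl, mul_add, Finset.mul_sum, mul_assoc]
      simp only [Finset.mul_sum, mul_assoc]
    have hswap : ∑ t ∈ Finset.Ioc s m, ∑ p ∈ Finset.Ico t m,
          W s t * F t p * ∑ q ∈ Finset.Ioc m N, W p q * F q N
        = ∑ p ∈ Finset.Ioo s m, F s p * ∑ q ∈ Finset.Ioc m N, W p q * F q N := by
      rw [Finset.sum_comm' (t' := Finset.Ioo s m) (s' := fun p => Finset.Ioc s p)]
      · refine Finset.sum_congr rfl fun p hp => ?_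
        rw [Finset.mem_Ioo] at hp
        rw [hrec s p hp.1 (by omega), Finset.sum_mul]
      · intro t p
        simp only [Finset.mem_Ioc, Finset.mem_Ico, Finset.mem_Ioo]
        omega
    rw [hrec s N (by omega) le_rfl, ← Finset.sum_Ioc_consecutive _ hsm hmN,
      Finset.sum_congr rfl hstep, Finset.sum_add_distrib, hswap, ← Finset.sum_mul,
      ← hrec s m hlt hmN, ← Finset.Ioo_insert_left hlt, Finset.sum_insert (by simp), hF]
    simp only [Finset.mul_sum, mul_assoc, one_mul]
    ring

/-- The recurrence of `weightedSum`, for the part of a board of length `N` between positions `s`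
and `e`, in terms of the position `t` at which the first tile ends. -/
theorem weightedSum_eq_sum_end {R : Type*} [CommRing R] (w : ℕ → ℕ → ℕ → R)
    (k : ℕ) {N s e : ℕ} (hse : s < e) (heN : e ≤ N) :
    weightedSum w k (e - s) s (N - e)
      = ∑ t ∈ Finset.Ioc s e, (if t - s ≤ k then w (t - s) (s + 1) (N - t) else 0)
          * weightedSum w k (e - t) t (N - e) := by
  rw [weightedSum_eq_sum_first w k (by omega), Finset.sum_filter]
  refine Finset.sum_bij' (fun i _ => s + i) (fun t _ => t - s) ?_ ?_ ?_ ?_ ?_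
  · intro i hi
    simp only [Finset.mem_Icc, Finset.mem_Ioc] at hi ⊢
    omega
  · intro t ht
    simp only [Finset.mem_Icc, Finset.mem_Ioc] at ht ⊢
    omega
  · intro i _
    omega
  · intro t ht
    rw [Finset.mem_Ioc] at ht
    omega
  · intro i hi
    rw [Finset.mem_Icc] at hi
    rw [ite_mul, zero_mul, Nat.add_sub_cancel_left, Nat.sub_sub,
      show N - e + (e - (s + i)) = N - (s + i) by omega]

/-- For all integers `m ≥ 1` and `n ≥ 1`,
`S_k(m+n,0,0) = S_k(m,0,n) · S_k(n,m,0)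
  + Σ_{i=2}^{k} Σ_{j=1}^{i-1} w(i, m-j+1, n-i+j) · S_k(m-j, 0, n+j) · S_k(n-i+j, m+i-j, 0)`,
where the double sum is restricted to pairs `(i,j)` with `j ≤ m` and `i - j ≤ n`. -/
theorem weightedSum_addition_formula {R : Type*} [CommRing R] (w : ℕ → ℕ → ℕ → R)
    (k : ℕ) (hk : 1 ≤ k) (m n : ℕ) (hm : 1 ≤ m) (hn : 1 ≤ n) :
    weightedSum w k (m + n) 0 0
      = weightedSum w k m 0 n * weightedSum w k n m 0 +
        ∑ i ∈ Finset.Icc 2 k, ∑ j ∈ Finset.Icc 1 (i - 1),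
          if j ≤ m ∧ i - j ≤ n then
            w i (m - j + 1) (n + j - i) * weightedSum w k (m - j) 0 (n + j) *
              weightedSum w k (n + j - i) (m + i - j) 0
          else 0 := by
  have hsplit := pathSum_split
    (F := fun s e => weightedSum w k (e - s) s (m + n - e))
    (W := fun s t => if t - s ≤ k then w (t - s) (s + 1) (m + n - t) else 0)
    (N := m + n) (fun s => by rw [Nat.sub_self, weightedSum_zero])
    (fun _ _ hse heN => weightedSum_eq_sum_end w k hse heN) (Nat.zero_le m) (Nat.le_add_right m n)
  simp only [Nat.sub_zero, Nat.sub_self, Nat.add_sub_cancel_left] at hsplit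
  rw [hsplit]
  congr 1
  simp only [mul_ite, ite_mul, mul_zero, zero_mul]
  rw [Finset.sum_sigma', Finset.sum_sigma', ← Finset.sum_filter, ← Finset.sum_filter]
  refine Finset.sum_bij' (fun x _ => ⟨x.2 - x.1, m - x.1⟩)
    (fun y _ => ⟨m - y.2, m + y.1 - y.2⟩) ?_ ?_ ?_ ?_ ?_
  · rintro ⟨p, q⟩ h
    simp only [Finset.mem_filter, Finset.mem_sigma, Finset.mem_Ico, Finset.mem_Ioc,
      Finset.mem_Icc] at h ⊢
    omega
  · rintro ⟨i, j⟩ h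
    simp only [Finset.mem_filter, Finset.mem_sigma, Finset.mem_Ico, Finset.mem_Ioc,
      Finset.mem_Icc] at h ⊢
    omega
  · rintro ⟨p, q⟩ h
    simp only [Finset.mem_filter, Finset.mem_sigma, Finset.mem_Ico, Finset.mem_Ioc] at h
    simp only [Sigma.mk.injEq, heq_eq_eq]
    omega
  · rintro ⟨i, j⟩ h
    simp only [Finset.mem_filter, Finset.mem_sigma, Finset.mem_Icc] at h
    simp only [Sigma.mk.injEq, heq_eq_eq]
    omega
  · rintro ⟨p, q⟩ h
    simp only [Finset.mem_filter, Finset.mem_sigma, Finset.mem_Ico, Finset.mem_Ioc] at h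
    dsimp only
    rw [show m - (m - p) = p by omega, show n + (m - p) - (q - p) = m + n - q by omega,
      show m + (q - p) - (m - p) = q by omega, show n + (m - p) = m + n - p by omega]
    ring
end

section
/- For all integers m ≥ 1 and n ≥ 1, F_{m+n} = q^{mn} · F_m · F_n + Σ_{i=2}^{k} Σ_{j=1}^{i−1} z_i · q^{i(n−i+j) + (m−j)(n+j)} · F_{m−j} · F_{n−i+j}, where the double sum is restricted to those pairs (i,j) with j ≤ m and i−j ≤ n. -/
/-- The generating polynomial of the inversion statistic over layered permutations of
`{1,…,n}` with layers of length at most `k`: the sum over all compositions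
`c = (c_1,…,c_m)` of `n` with parts in `{1,…,k}` of `∏_{j=1}^m z_{c_j} q^{c_j (n - p_j)}`,
where `p_j` are the partial sums of `c`. -/
def invGenPoly {R : Type*} [CommRing R] (k : ℕ) (q : R) (z : ℕ → R) (n : ℕ) : R :=
  ∑ c ∈ Finset.univ.filter (fun c : Composition n => ∀ i ∈ c.blocks, i ≤ k),
    ∏ j ∈ Finset.range c.length,
      z (c.blocks.getD j 0) * q ^ (c.blocks.getD j 0 * (n - c.sizeUpTo (j + 1)))

/-- The weight `∏ z_{c_j} q^{c_j (n - p_j)}` of a list of parts `c` with sum `n`,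
by recursion on the list. -/
def partsWeight {R : Type*} [CommRing R] (q : R) (z : ℕ → R) : List ℕ → R
  | [] => 1
  | a :: l => z a * q ^ (a * l.sum) * partsWeight q z l

theorem prod_range_eq_partsWeight {R : Type*} [CommRing R] (q : R) (z : ℕ → R) (l : List ℕ) :
    ∏ j ∈ Finset.range l.length,
      z (l.getD j 0) * q ^ (l.getD j 0 * (l.sum - (l.take (j + 1)).sum)) = partsWeight q z l := by
  induction l with
  | nil => simp [partsWeight]
  | cons a l ih =>
    rw [List.length_cons, Finset.prod_range_succ', partsWeight, ← ih, mul_comm]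
    simp [Nat.add_sub_add_left]

/-- The compositions of `n` with parts in `{1,…,k}`, as lists. -/
def boundedParts (k n : ℕ) : Finset (List ℕ) :=
  (Finset.univ.filter fun c : Composition n => ∀ i ∈ c.blocks, i ≤ k).image Composition.blocks

theorem mem_boundedParts {k n : ℕ} {l : List ℕ} :
    l ∈ boundedParts k n ↔ l.sum = n ∧ ∀ i ∈ l, 1 ≤ i ∧ i ≤ k := by
  simp only [boundedParts, Finset.mem_image, Finset.mem_filter, Finset.mem_univ, true_and]
  constructor
  · rintro ⟨c, hc, rfl⟩
    exact ⟨c.blocks_sum, fun i hi => ⟨c.one_le_blocks hi, hc i hi⟩⟩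
  · rintro ⟨hs, h⟩
    exact ⟨⟨l, fun {i} hi => (h i hi).1, hs⟩, fun i hi => (h i hi).2, rfl⟩

theorem invGenPoly_eq_sum_boundedParts {R : Type*} [CommRing R] (k : ℕ) (q : R) (z : ℕ → R)
    (n : ℕ) : invGenPoly k q z n = ∑ l ∈ boundedParts k n, partsWeight q z l := by
  rw [boundedParts, Finset.sum_image fun c _ d _ h => Composition.ext h, invGenPoly]
  refine Finset.sum_congr rfl fun c _ => ?_
  rw [← prod_range_eq_partsWeight, c.blocks_sum]
  rfl

theorem boundedParts_eq_biUnion {k n : ℕ} (hn : 1 ≤ n) :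
    boundedParts k n = ((Finset.Icc 1 k).filter (· ≤ n)).biUnion
      fun i => (boundedParts k (n - i)).image (List.cons i) := by
  ext l
  simp only [Finset.mem_biUnion, Finset.mem_filter, Finset.mem_Icc, Finset.mem_image,
    mem_boundedParts]
  constructor
  · rintro ⟨hs, h⟩
    cases l with
    | nil => simp at hs; omega
    | cons a l =>
      rw [List.sum_cons] at hs
      rw [List.forall_mem_cons] at h
      exact ⟨a, ⟨h.1, by omega⟩, l, ⟨by omega, h.2⟩, rfl⟩
  · rintro ⟨a, ⟨ha, han⟩, l, ⟨hs, h⟩, rfl⟩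
    rw [List.sum_cons, List.forall_mem_cons]
    exact ⟨by omega, ha, h⟩

theorem invGenPoly_zero {R : Type*} [CommRing R] (k : ℕ) (q : R) (z : ℕ → R) :
    invGenPoly k q z 0 = 1 := by
  have h : boundedParts k 0 = {[]} := by
    ext l
    rw [mem_boundedParts, Finset.mem_singleton]
    constructor
    · rintro ⟨hs, h⟩
      cases l with
      | nil => rfl
      | cons a l =>
        have := (h a List.mem_cons_self).1
        rw [List.sum_cons] at hs
        omega
    · rintro rfl
      simp
  rw [invGenPoly_eq_sum_boundedParts, h, Finset.sum_singleton, partsWeight]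

/-- Recurrence obtained by splitting off the first part. -/
theorem invGenPoly_eq_sum_first {R : Type*} [CommRing R] (k : ℕ) (q : R) (z : ℕ → R)
    {n : ℕ} (hn : 1 ≤ n) :
    invGenPoly k q z n = ∑ i ∈ Finset.Icc 1 k,
      if i ≤ n then z i * q ^ (i * (n - i)) * invGenPoly k q z (n - i) else 0 := by
  rw [invGenPoly_eq_sum_boundedParts, boundedParts_eq_biUnion hn, Finset.sum_biUnion,
    Finset.sum_filter]
  · refine Finset.sum_congr rfl fun i _ => ?_
    split_ifs
    · rw [Finset.sum_image fun _ _ _ _ h => (List.cons.inj h).2, invGenPoly_eq_sum_boundedParts,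
        Finset.mul_sum]
      refine Finset.sum_congr rfl fun l hl => ?_
      rw [partsWeight, (mem_boundedParts.1 hl).1]
    · rfl
  · intro i _ j _ hij
    rw [Function.onFun, Finset.disjoint_left]
    intro l hi hj
    obtain ⟨l₁, -, rfl⟩ := Finset.mem_image.1 hi
    obtain ⟨l₂, -, h⟩ := Finset.mem_image.1 hj
    exact hij (List.cons.inj h).1.symm

/-- The recurrence for `m ≥ 1`, with every term rescaled by the power of `q` accounting for
`s` further letters on the right. -/
theorem pow_mul_invGenPoly_eq_sum_first {R : Type*} [CommRing R] (k : ℕ) (q : R) (z : ℕ → R)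
    {m : ℕ} (hm : 1 ≤ m) (s : ℕ) :
    q ^ (m * s) * invGenPoly k q z m = ∑ i ∈ Finset.Icc 1 k,
      if i ≤ m then z i * q ^ (i * (m + s - i)) * (q ^ ((m - i) * s) * invGenPoly k q z (m - i))
      else 0 := by
  rw [invGenPoly_eq_sum_first k q z hm, Finset.mul_sum]
  refine Finset.sum_congr rfl fun i _ => ?_
  split_ifs with h
  · obtain ⟨d, rfl⟩ := Nat.exists_eq_add_of_le h
    rw [add_assoc, Nat.add_sub_cancel_left, Nat.add_sub_cancel_left]
    ring
  · rw [mul_zero]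

/-- The total weight of the compositions of `m + n` in which a part straddles position `m`. -/
def straddlingSum {R : Type*} [CommRing R] (k : ℕ) (q : R) (z : ℕ → R) (m n : ℕ) : R :=
  ∑ i ∈ Finset.Icc 2 k, ∑ j ∈ Finset.Icc 1 (i - 1),
    if j ≤ m ∧ i - j ≤ n then
      z i * q ^ (i * (n + j - i) + (m - j) * (n + j)) *
        invGenPoly k q z (m - j) * invGenPoly k q z (n + j - i)
    else 0

theorem straddlingSum_zero {R : Type*} [CommRing R] (k : ℕ) (q : R) (z : ℕ → R) (n : ℕ) :
    straddlingSum k q z 0 n = 0 := by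
  refine Finset.sum_eq_zero fun i _ => Finset.sum_eq_zero fun j hj => if_neg ?_
  rw [Finset.mem_Icc] at hj
  omega

/-- Splitting off the first part, which either ends at or before position `m`, or itself
straddles it. -/
theorem straddlingSum_eq_sum_first {R : Type*} [CommRing R] (k : ℕ) (q : R) (z : ℕ → R)
    {m n : ℕ} (hm : 1 ≤ m) :
    straddlingSum k q z m n =
      (∑ i ∈ Finset.Icc 1 k,
        if i ≤ m then z i * q ^ (i * (m + n - i)) * straddlingSum k q z (m - i) n else 0) +
      ∑ i ∈ Finset.Icc 1 k,
        if m < i ∧ i ≤ m + n then z i * q ^ (i * (m + n - i)) * invGenPoly k q z (m + n - i)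
        else 0 := by
  have first_straddles : ∑ i ∈ Finset.Icc 1 k,
        (if m < i ∧ i ≤ m + n then z i * q ^ (i * (m + n - i)) * invGenPoly k q z (m + n - i)
        else 0) = ∑ i ∈ Finset.Icc 2 k, ∑ j ∈ Finset.Icc 1 (i - 1),
        if j = m ∧ i - j ≤ n then z i * q ^ (i * (n + j - i)) * invGenPoly k q z (n + j - i)
        else 0 := by
    rw [← Finset.sum_subset (Finset.Icc_subset_Icc_left one_le_two)]
    · refine Finset.sum_congr rfl fun i _ => ?_
      by_cases hi : m < i
      · rw [Finset.sum_eq_single_of_mem m (Finset.mem_Icc.2 ⟨hm, by omega⟩)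
          fun j _ hj => if_neg fun h => hj h.1]
        rw [add_comm n m]
        exact if_congr (by omega) rfl rfl
      · rw [if_neg fun h => hi h.1]
        refine (Finset.sum_eq_zero fun j hj => if_neg ?_).symm
        rw [Finset.mem_Icc] at hj
        omega
    · intro i hi hi'
      rw [Finset.mem_Icc] at hi hi'
      exact if_neg (by omega)
  have first_precedes : ∑ l ∈ Finset.Icc 1 k,
        (if l ≤ m then z l * q ^ (l * (m + n - l)) * straddlingSum k q z (m - l) n else 0) =
      ∑ i ∈ Finset.Icc 2 k, ∑ j ∈ Finset.Icc 1 (i - 1), ∑ l ∈ Finset.Icc 1 k,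
        if l ≤ m then z l * q ^ (l * (m + n - l)) *
          (if j ≤ m - l ∧ i - j ≤ n then
            z i * q ^ (i * (n + j - i) + (m - l - j) * (n + j)) *
              invGenPoly k q z (m - l - j) * invGenPoly k q z (n + j - i)
          else 0) else 0 := by
    rw [Finset.sum_congr rfl fun i _ => Finset.sum_comm, Finset.sum_comm]
    refine Finset.sum_congr rfl fun l _ => ?_
    split_ifs
    · simp only [straddlingSum, Finset.mul_sum]
    · simp
  rw [first_straddles, first_precedes, straddlingSum, ← Finset.sum_add_distrib]
  refine Finset.sum_congr rfl fun i _ => ?_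
  rw [← Finset.sum_add_distrib]
  refine Finset.sum_congr rfl fun j hj => ?_
  rw [Finset.mem_Icc] at hj
  by_cases hij : i - j ≤ n
  swap
  · simp [hij]
  rcases lt_trichotomy j m with hjm | rfl | hjm
  · rw [if_pos ⟨hjm.le, hij⟩, if_neg fun h => hjm.ne h.1, add_zero]
    have key := pow_mul_invGenPoly_eq_sum_first k q z (m := m - j) (by omega) (n + j)
    calc _ = z i * q ^ (i * (n + j - i)) * invGenPoly k q z (n + j - i) *
          (q ^ ((m - j) * (n + j)) * invGenPoly k q z (m - j)) := by ring
      _ = _ := by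
        rw [key, Finset.mul_sum]
        refine Finset.sum_congr rfl fun l hl => ?_
        rw [Finset.mem_Icc] at hl
        by_cases hl' : l ≤ m - j
        · rw [if_pos hl', if_pos (by omega), if_pos (by omega), Nat.sub_right_comm m l j,
            show m - j + (n + j) - l = m + n - l by omega]
          ring
        · rw [if_neg hl', mul_zero]
          split_ifs <;> first | omega | simp
  · rw [if_pos ⟨le_rfl, hij⟩, if_pos ⟨rfl, hij⟩, Finset.sum_eq_zero, Nat.sub_self,
      invGenPoly_zero]
    · ring
    · intro l hl
      rw [Finset.mem_Icc] at hl
      split_ifs <;> first | omega | simp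
  · rw [if_neg (by omega), if_neg (by omega), Finset.sum_eq_zero, add_zero]
    intro l hl
    rw [Finset.mem_Icc] at hl
    split_ifs <;> first | omega | simp

theorem invGenPoly_add {R : Type*} [CommRing R] (k : ℕ) (q : R) (z : ℕ → R) (m n : ℕ) :
    invGenPoly k q z (m + n) =
      q ^ (m * n) * invGenPoly k q z m * invGenPoly k q z n + straddlingSum k q z m n := by
  induction m using Nat.strong_induction_on with
  | _ m ih =>
    rcases Nat.eq_zero_or_pos m with rfl | hm
    · simp [invGenPoly_zero, straddlingSum_zero]
    rw [invGenPoly_eq_sum_first k q z (show 1 ≤ m + n by omega),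
      pow_mul_invGenPoly_eq_sum_first k q z hm, straddlingSum_eq_sum_first k q z hm,
      Finset.sum_mul, ← add_assoc, ← Finset.sum_add_distrib, ← Finset.sum_add_distrib]
    refine Finset.sum_congr rfl fun i hi => ?_
    rw [Finset.mem_Icc] at hi
    by_cases him : i ≤ m
    · rw [if_pos (by omega), if_pos him, if_pos him, if_neg (by omega),
        show m + n - i = m - i + n by omega, ih (m - i) (by omega)]
      ring
    · simp only [him, if_false, zero_mul, zero_add]
      exact if_congr (by omega) rfl rfl

/-- For all integers `m ≥ 1` and `n ≥ 1`,
`F_{m+n} = q^{mn} · F_m · F_n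
  + Σ_{i=2}^{k} Σ_{j=1}^{i-1} z_i · q^{i(n-i+j) + (m-j)(n+j)} · F_{m-j} · F_{n-i+j}`,
the double sum being restricted to pairs `(i,j)` with `j ≤ m` and `i - j ≤ n`. -/
theorem invGenPoly_addition_formula {R : Type*} [CommRing R] (k : ℕ) (hk : 2 ≤ k)
    (q : R) (z : ℕ → R) (m n : ℕ) (hm : 1 ≤ m) (hn : 1 ≤ n) :
    invGenPoly k q z (m + n)
      = q ^ (m * n) * invGenPoly k q z m * invGenPoly k q z n +
        ∑ i ∈ Finset.Icc 2 k, ∑ j ∈ Finset.Icc 1 (i - 1),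
          if j ≤ m ∧ i - j ≤ n then
            z i * q ^ (i * (n + j - i) + (m - j) * (n + j)) *
              invGenPoly k q z (m - j) * invGenPoly k q z (n + j - i)
          else 0 :=
  invGenPoly_add k q z m n
end

section
/- Let k ≥ 1 and n ≥ 1 be integers and let M be the k×k matrix over R with rows and columns indexed by 0,…,k−1 whose (i,j) entry is F_{n+k−1+j−i}. Then det M = ε · z_k^{n+k−1} · q^{(n+k−1)·C(k,2)}, where C(k,2) = k(k−1)/2, ε = 1 if k is odd, and ε = (−1)^{n−1} if k is even. -/
/-- The generating polynomial of the inversion statistic over reverse layered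
permutations of `{1,…,n}` with layers of length at most `k`: the sum over all
compositions `c = (c_1,…,c_m)` of `n` with parts in `{1,…,k}` of
`∏_{j=1}^m z_{c_j} q^{C(c_j,2)}`. -/
def rinvGenPoly {R : Type*} [CommRing R] (k : ℕ) (q : R) (z : ℕ → R) (n : ℕ) : R :=
  ∑ c ∈ Finset.univ.filter (fun c : Composition n => ∀ i ∈ c.blocks, i ≤ k),
    ∏ j ∈ Finset.range c.length,
      z (c.blocks.getD j 0) * q ^ Nat.choose (c.blocks.getD j 0) 2

theorem List.prod_range_getD_eq_prod_map {M : Type*} [CommMonoid M] (f : ℕ → M) (l : List ℕ) :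
    ∏ j ∈ Finset.range l.length, f (l.getD j 0) = (l.map f).prod := by
  induction l with
  | nil => simp
  | cons a l ih => simp [Finset.prod_range_succ', ← ih, mul_comm]

/-- Prepend a block of length `s + 1` to a composition of `n - s`. -/
def Composition.consBlock {n : ℕ} (s : Fin (n + 1)) (c : Composition (n - s)) :
    Composition (n + 1) where
  blocks := (s + 1 : ℕ) :: c.blocks
  blocks_pos := by
    intro i hi
    rcases List.mem_cons.1 hi with rfl | hi
    · omega
    · exact c.blocks_pos hi
  blocks_sum := by
    have := s.isLt
    rw [List.sum_cons, c.blocks_sum]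
    omega

theorem Composition.consBlock_bijective (n : ℕ) :
    Function.Bijective
      (fun x : (s : Fin (n + 1)) × Composition (n - s) => consBlock x.1 x.2) := by
  constructor
  · rintro ⟨s, c⟩ ⟨t, d⟩ h
    have hb := congrArg Composition.blocks h
    simp only [consBlock, List.cons.injEq, Nat.add_right_cancel_iff] at hb
    obtain rfl : s = t := Fin.ext hb.1
    obtain rfl : c = d := Composition.ext hb.2
    rfl
  · rintro ⟨blocks, hpos, hsum⟩
    cases blocks with
    | nil => simp at hsum
    | cons a l =>
      have ha : 0 < a := hpos (by simp)
      rw [List.sum_cons] at hsum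
      refine ⟨⟨⟨a - 1, by omega⟩, ⟨l, fun hi => hpos (List.mem_cons_of_mem _ hi), ?_⟩⟩, ?_⟩
      · show l.sum = n - (a - 1)
        omega
      · apply Composition.ext
        show (a - 1 + 1) :: l = a :: l
        rw [Nat.sub_add_cancel ha]

section

variable {R : Type*} [CommRing R]

open Finset

theorem rinvGenPoly_eq_sum_ite (k : ℕ) (q : R) (z : ℕ → R) (n : ℕ) :
    rinvGenPoly k q z n = ∑ c : Composition n, if ∀ i ∈ c.blocks, i ≤ k then
      (c.blocks.map fun i => z i * q ^ Nat.choose i 2).prod else 0 := by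
  rw [rinvGenPoly, sum_filter]
  refine sum_congr rfl fun c _ => ?_
  rw [← List.prod_range_getD_eq_prod_map]

theorem rinvGenPoly_zero (k : ℕ) (q : R) (z : ℕ → R) : rinvGenPoly k q z 0 = 1 := by
  have h : ∀ c : Composition 0, c.blocks = [] := fun c =>
    List.eq_nil_iff_forall_not_mem.2 fun i hi =>
      (c.blocks_pos hi).ne' (List.sum_eq_zero_iff.1 c.blocks_sum i hi)
  simp [rinvGenPoly_eq_sum_ite, h, composition_card]

theorem rinvGenPoly_succ (k : ℕ) (q : R) (z : ℕ → R) (n : ℕ) :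
    rinvGenPoly k q z (n + 1) = ∑ s ∈ range (n + 1),
      if s < k then z (s + 1) * q ^ Nat.choose (s + 1) 2 * rinvGenPoly k q z (n - s) else 0 := by
  rw [sum_range, rinvGenPoly_eq_sum_ite,
    ← (Composition.consBlock_bijective n).sum_comp, Fintype.sum_sigma]
  refine sum_congr rfl fun s _ => ?_
  rw [rinvGenPoly_eq_sum_ite, mul_sum]
  by_cases hs : (s : ℕ) < k
  · rw [if_pos hs]
    refine sum_congr rfl fun c _ => ?_
    simp [Composition.consBlock, Nat.succ_le_of_lt hs]
  · rw [if_neg hs]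
    refine sum_eq_zero fun c _ => if_neg fun h => hs ?_
    exact h (s + 1) (by simp [Composition.consBlock])

/-- `rinvGenPoly (p + 1)` shifted by `p` and extended by zero: it satisfies the linear recurrence
of order `p + 1` everywhere, with initial values `0, …, 0, 1`. -/
def shiftedRinvGenPoly (p : ℕ) (q : R) (z : ℕ → R) (m : ℕ) : R :=
  if p ≤ m then rinvGenPoly (p + 1) q z (m - p) else 0

theorem shiftedRinvGenPoly_add (p : ℕ) (q : R) (z : ℕ → R) (m : ℕ) :
    shiftedRinvGenPoly p q z (m + p + 1) = ∑ s ∈ range (p + 1),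
      z (s + 1) * q ^ Nat.choose (s + 1) 2 * shiftedRinvGenPoly p q z (m + p - s) := by
  rw [shiftedRinvGenPoly, if_pos (by omega), show m + p + 1 - p = m + 1 by omega,
    rinvGenPoly_succ, ← sum_filter]
  simp only [shiftedRinvGenPoly, mul_ite, mul_zero]
  rw [← sum_filter]
  refine sum_congr ?_ fun s hs => ?_
  · ext s
    simp only [mem_filter, mem_range]
    omega
  · rw [show m + p - s - p = m - s by omega]

/-- The companion matrix with ones below the diagonal and last column `a`. -/
def lastColCompanion {p : ℕ} (a : Fin (p + 1) → R) : Matrix (Fin (p + 1)) (Fin (p + 1)) R :=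
  Matrix.of fun i j => Fin.lastCases (a i) (fun j' => if i = j'.succ then 1 else 0) j

theorem det_lastColCompanion {p : ℕ} (a : Fin (p + 1) → R) :
    (lastColCompanion a).det = (-1) ^ p * a 0 := by
  rw [Matrix.det_succ_row_zero, Fin.sum_univ_castSucc]
  have h : (lastColCompanion a).submatrix Fin.succ (Fin.last p).succAbove = 1 := by
    ext i j
    simp [lastColCompanion, Matrix.one_apply]
  rw [h]
  simp [lastColCompanion, (Fin.succ_ne_zero _).symm]

theorem det_shiftedRinvGenPoly (p : ℕ) (q : R) (z : ℕ → R) (N : ℕ) :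
    Matrix.det (Matrix.of fun i j : Fin (p + 1) =>
        shiftedRinvGenPoly p q z (N + p + (j : ℕ) - (i : ℕ)))
      = ((-1) ^ p * (z (p + 1) * q ^ Nat.choose (p + 1) 2)) ^ N := by
  induction N with
  | zero =>
    rw [Matrix.det_of_isUpperTriangular]
    · refine (prod_eq_one fun i _ => ?_).trans (pow_zero _).symm
      simp [shiftedRinvGenPoly, rinvGenPoly_zero]
    · intro i j hij
      have hij' : (j : ℕ) < i := hij
      have := i.isLt
      exact if_neg (by omega)
  | succ N ih =>
    have h : (Matrix.of fun i j : Fin (p + 1) =>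
          shiftedRinvGenPoly p q z (N + 1 + p + (j : ℕ) - (i : ℕ)))
        = (Matrix.of fun i j : Fin (p + 1) =>
            shiftedRinvGenPoly p q z (N + p + (j : ℕ) - (i : ℕ))) *
          lastColCompanion fun i : Fin (p + 1) =>
            z (p - i + 1) * q ^ Nat.choose (p - i + 1) 2 := by
      ext i j
      have := i.isLt
      rw [Matrix.mul_apply]
      induction j using Fin.lastCases with
      | last =>
        simp only [lastColCompanion, Matrix.of_apply, Fin.lastCases_last, Fin.val_last]
        rw [show N + 1 + p + p - (i : ℕ) = N + p - i + p + 1 by omega, shiftedRinvGenPoly_add,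
          ← sum_range_reflect, sum_range]
        refine sum_congr rfl fun j _ => ?_
        have := j.isLt
        rw [mul_comm, show p + 1 - 1 - (j : ℕ) = p - j by omega,
          show N + p - (i : ℕ) + p - (p - j) = N + p + j - i by omega]
      | cast j =>
        simp only [lastColCompanion, Matrix.of_apply, Fin.lastCases_castSucc, Fin.val_castSucc,
          mul_ite, mul_one, mul_zero, sum_ite_eq', mem_univ, if_true, Fin.val_succ]
        congr 1
        omega
    rw [h, Matrix.det_mul, ih, det_lastColCompanion, pow_succ]
    simp

end

/-- Let `k ≥ 1` and `n ≥ 1` and let `M` be the `k × k` matrix over `R`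
whose `(i,j)` entry is `F_{n+k-1+j-i}`. Then
`det M = ε · z_k^{n+k-1} · q^{(n+k-1)·C(k,2)}`, where `ε = 1` if `k` is odd and
`ε = (-1)^{n-1}` if `k` is even. -/
theorem rinvGenPoly_toeplitz_determinant {R : Type*} [CommRing R] (k : ℕ) (hk : 1 ≤ k)
    (q : R) (z : ℕ → R) (n : ℕ) (hn : 1 ≤ n) :
    Matrix.det (Matrix.of fun i j : Fin k =>
        rinvGenPoly k q z (n + k - 1 + (j : ℕ) - (i : ℕ)))
      = (if Odd k then 1 else (-1) ^ (n - 1)) *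
          z k ^ (n + k - 1) * q ^ ((n + k - 1) * Nat.choose k 2) := by
  obtain ⟨p, rfl⟩ : ∃ p, k = p + 1 := ⟨k - 1, by omega⟩
  obtain ⟨m, rfl⟩ : ∃ m, n = m + 1 := ⟨n - 1, by omega⟩
  have h := det_shiftedRinvGenPoly p q z (m + 1 + p)
  have hM : (Matrix.of fun i j : Fin (p + 1) =>
        shiftedRinvGenPoly p q z (m + 1 + p + p + (j : ℕ) - (i : ℕ)))
      = Matrix.of fun i j : Fin (p + 1) =>
        rinvGenPoly (p + 1) q z (m + 1 + (p + 1) - 1 + (j : ℕ) - (i : ℕ)) := by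
    ext i j
    have := i.isLt
    rw [Matrix.of_apply, Matrix.of_apply, shiftedRinvGenPoly, if_pos (by omega)]
    congr 1
    omega
  have hε : ((-1 : R) ^ p) ^ (m + 1 + p) = if Odd (p + 1) then 1 else (-1) ^ m := by
    rcases Nat.even_or_odd p with hp | hp
    · rw [if_pos hp.add_one, hp.neg_one_pow, one_pow]
    · rw [if_neg (Nat.not_odd_iff_even.2 hp.add_one), hp.neg_one_pow, add_assoc, pow_add,
        (add_comm p 1 ▸ hp.add_one : Even (1 + p)).neg_one_pow, mul_one]
  rw [← hM, h, mul_pow, mul_pow, hε, ← pow_mul, mul_comm (Nat.choose (p + 1) 2), ← mul_assoc]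
  rfl
end
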